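/- Let μ be an admissible probability measure on ℝ with second characteristic ψ, and let Λ(μ) = {t > 0 : exp(tψ) is the characteristic function of some probability measure on ℝ}. If the interior of Λ(μ) in ℝ is nonempty, then there exists λ > 0 such that [λ,∞) ⊆ Λ(μ). -/

import Mathlib

open MeasureTheory

/-- The characteristic function of a measure on `ℝ`. -/
noncomputable def charFunR (μ : Measure ℝ) (y : ℝ) : ℂ :=
  ∫ x, Complex.exp (Complex.I * y * x) ∂μ

/-- `Λ(μ)` for an admissible measure with second characteristic `ψ`:
the set of `t > 0` such that `exp (t ψ)` is a characteristic function. -/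
def Lam (ψ : ℝ → ℂ) : Set ℝ :=
  {t | 0 < t ∧ ∃ ν : Measure ℝ, IsProbabilityMeasure ν ∧
    ∀ y, charFunR ν y = Complex.exp (t * ψ y)}

lemma charFunR_eq_charFun (μ : Measure ℝ) (y : ℝ) : charFunR μ y = charFun μ y := by
  rw [charFun_apply_real, charFunR]
  congr 1 with x
  ring_nf

lemma add_mem_Lam {ψ : ℝ → ℂ} {s t : ℝ} (hs : s ∈ Lam ψ) (ht : t ∈ Lam ψ) :
    s + t ∈ Lam ψ := by
  obtain ⟨hs, μ, _, hμ⟩ := hs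
  obtain ⟨ht, ν, _, hν⟩ := ht
  refine ⟨add_pos hs ht, μ.conv ν, inferInstance, fun y => ?_⟩
  rw [charFunR_eq_charFun, charFun_conv, ← charFunR_eq_charFun, ← charFunR_eq_charFun, hμ, hν,
    ← Complex.exp_add]
  push_cast
  ring_nf

lemma natCast_mul_mem_Lam {ψ : ℝ → ℂ} {t : ℝ} (ht : t ∈ Lam ψ) {n : ℕ} (hn : 1 ≤ n) :
    n * t ∈ Lam ψ := by
  induction n, hn using Nat.le_induction with
  | base => simpa using ht
  | succ n _ ih =>
    rw [Nat.cast_succ, add_one_mul]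
    exact add_mem_Lam ih ht

/-- If the interior of `Λ(μ)` is nonempty, then `Λ(μ)` contains a half line
`[λ, ∞)` for some `λ > 0`. -/
theorem Lam_interior_nonempty (μ : Measure ℝ) [IsProbabilityMeasure μ]
    (ψ : ℝ → ℂ) (hψc : Continuous ψ) (hψ0 : ψ 0 = 0)
    (hμψ : ∀ y, charFunR μ y = Complex.exp (ψ y))
    (h : (interior (Lam ψ)).Nonempty) :
    ∃ lam > (0 : ℝ), Set.Ici lam ⊆ Lam ψ := by
  obtain ⟨x, hx⟩ := h
  have hx0 : 0 < x := (interior_subset hx).1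
  obtain ⟨ε, hε, hball⟩ := Metric.mem_nhds_iff.mp (mem_interior_iff_mem_nhds.mp hx)
  refine ⟨x * (x / ε + 1), by positivity, fun t ht => ?_⟩
  set n := ⌊t / x⌋₊
  have htx : x / ε + 1 ≤ t / x := by
    rw [le_div_iff₀ hx0, mul_comm]
    exact ht
  have hxε : 0 < x / ε := by positivity
  have hlt : t / x < n + 1 := Nat.lt_floor_add_one _
  have hle : n ≤ t / x := Nat.floor_le (by linarith)
  have hxn : x / ε < n := by linarith
  have hn : (0 : ℝ) < n := hxε.trans hxn
  rw [div_lt_iff₀ hε] at hxn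
  rw [div_lt_iff₀ hx0] at hlt
  rw [le_div_iff₀ hx0] at hle
  have hmem : t / n ∈ Lam ψ := by
    apply hball
    rw [Metric.mem_ball, Real.dist_eq, abs_lt, lt_sub_iff_add_lt, sub_lt_iff_lt_add,
      lt_div_iff₀ hn, div_lt_iff₀ hn]
    constructor <;> nlinarith
  rw [← mul_div_cancel₀ t hn.ne']
  simpa [mul_div_assoc] using natCast_mul_mem_Lam hmem (Nat.cast_pos.mp hn)
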